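/- Let n ≥ 2, integers a ≥ 1, b ≥ 0 and 0 ≤ r ≤ n − 2. Every p ∈ 𝒫_{a,b,r} admits a unique decomposition p = x + z̲̃ · q, where x ∈ 𝒫_{a,b,r} with ∂z̃ x = 0, q ∈ 𝒫_{a−1,b,r+1} with ∂z̃ q = 0, and z̲̃ · q denotes the pointwise left multiplication z ↦ z̲̃(z) q(z) with z̲̃(z) = Σ_{j=1}^{n−1} 𝔣_j z_j. (Fischer decomposition 𝒫_{a,b,r} = (Ker ∂z̃ ∩ 𝒫_{a,b,r}) ⊕ z̲̃ (Ker ∂z̃ ∩ 𝒫_{a−1,b,r+1}).) -/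

import Mathlib

noncomputable section

/-- The negative definite quadratic form `-∑ vᵢ²` on `K^m`. -/
def negQ (K : Type) [Field K] (m : ℕ) : QuadraticForm K (Fin m → K) :=
  QuadraticMap.weightedSumSquares K (fun _ : Fin m => (-1 : K))

/-- The complex Clifford algebra `ℂ_{2n}`, generated by `e_1, …, e_{2n}` with
`e_α e_β + e_β e_α = -2 δ_{αβ}`. -/
abbrev Cl (n : ℕ) : Type := CliffordAlgebra (negQ ℂ (n + n))

/-- The generators `e_α`, `α = 1, …, 2n`, of `ℂ_{2n}`. -/
def e (n : ℕ) (α : Fin (n + n)) : Cl n := CliffordAlgebra.ι (negQ ℂ (n + n)) (Pi.single α 1)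

/-- The Witt basis element `𝔣_j = ½(e_j - i e_{n+j})`. -/
def ff (n : ℕ) (j : Fin n) : Cl n :=
  (2⁻¹ : ℂ) • (e n (Fin.castAdd n j) - Complex.I • e n (Fin.natAdd n j))

/-- The Witt basis element `𝔣_j† = -½(e_j + i e_{n+j})`. -/
def ffd (n : ℕ) (j : Fin n) : Cl n :=
  -((2⁻¹ : ℂ) • (e n (Fin.castAdd n j) + Complex.I • e n (Fin.natAdd n j)))

/-- `f : ℂ^m → ℂ_{2n}` has directional derivative `d` at `z` in direction `v`
(componentwise, i.e. tested against all linear functionals on the finite-dimensional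
space `ℂ_{2n}`; here `ℂ^m` is regarded as the real vector space `ℝ^{2m}`). -/
def HasDirDeriv {n m : ℕ} (f : (Fin m → ℂ) → Cl n) (z v : Fin m → ℂ) (d : Cl n) : Prop :=
  ∀ φ : Cl n →ₗ[ℂ] ℂ, HasDerivAt (fun t : ℝ => φ (f (z + t • v))) (φ d) 0

/-- The directional derivative of `f` at `z` in direction `v` (junk value if none exists). -/
def dirDeriv {n m : ℕ} (f : (Fin m → ℂ) → Cl n) (v : Fin m → ℂ) (z : Fin m → ℂ) : Cl n :=
  letI : Nonempty (Cl n) := ⟨0⟩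
  Classical.epsilon fun d => HasDirDeriv f z v d

/-- The Cauchy–Riemann operator `∂_{z_j} = ½(∂_{x_j} - i ∂_{y_j})`. -/
def pz {n m : ℕ} (j : Fin m) (f : (Fin m → ℂ) → Cl n) : (Fin m → ℂ) → Cl n := fun z =>
  (2⁻¹ : ℂ) • (dirDeriv f (Pi.single j 1) z - Complex.I • dirDeriv f (Pi.single j Complex.I) z)

/-- The conjugate Cauchy–Riemann operator `∂_{z_j^c} = ½(∂_{x_j} + i ∂_{y_j})`. -/
def pzc {n m : ℕ} (j : Fin m) (f : (Fin m → ℂ) → Cl n) : (Fin m → ℂ) → Cl n := fun z =>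
  (2⁻¹ : ℂ) • (dirDeriv f (Pi.single j 1) z + Complex.I • dirDeriv f (Pi.single j Complex.I) z)

/-- The Hermitean Dirac operator `∂_z g = ∑_j 𝔣_j† ∂_{z_j} g` on functions `ℂ^n → ℂ_{2n}`. -/
def dzFull (n : ℕ) (g : (Fin n → ℂ) → Cl n) (z : Fin n → ℂ) : Cl n :=
  ∑ j : Fin n, ffd n j * pz j g z

/-- The Hermitean Dirac operator `∂_z† g = ∑_j 𝔣_j ∂_{z_j^c} g` on functions `ℂ^n → ℂ_{2n}`. -/
def dzdFull (n : ℕ) (g : (Fin n → ℂ) → Cl n) (z : Fin n → ℂ) : Cl n :=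
  ∑ j : Fin n, ff n j * pzc j g z

/-- `g : ℂ^n → ℂ_{2n}` is Hermitean monogenic (everywhere). -/
def HMonogenic (n : ℕ) (g : (Fin n → ℂ) → Cl n) : Prop :=
  ∀ z, dzFull n g z = 0 ∧ dzdFull n g z = 0

/-- The restricted Hermitean Dirac operator `∂_z̃ g = ∑_{j<n} 𝔣_j† ∂_{z_j} g` on functions
`ℂ^{n-1} → ℂ_{2n}`. -/
def dzT (n : ℕ) (g : (Fin (n - 1) → ℂ) → Cl n) (z : Fin (n - 1) → ℂ) : Cl n :=
  ∑ j : Fin (n - 1), ffd n (Fin.castLE (Nat.sub_le n 1) j) * pz j g z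

/-- The restricted Hermitean Dirac operator `∂_z̃† g = ∑_{j<n} 𝔣_j ∂_{z_j^c} g` on functions
`ℂ^{n-1} → ℂ_{2n}`. -/
def dzdT (n : ℕ) (g : (Fin (n - 1) → ℂ) → Cl n) (z : Fin (n - 1) → ℂ) : Cl n :=
  ∑ j : Fin (n - 1), ff n (Fin.castLE (Nat.sub_le n 1) j) * pzc j g z

/-- `p : ℂ^m → ℂ_{2n}` is a polynomial map (in the underlying real coordinates,
equivalently in `z_j` and their conjugates) with coefficients in `ℂ_{2n}`. -/
def IsPolyMap (n m : ℕ) (p : (Fin m → ℂ) → Cl n) : Prop :=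
  ∃ (N : ℕ) (c : Fin N → Cl n) (dx dy : Fin N → Fin m → ℕ),
    ∀ z, p z = ∑ t, (∏ j, (z j) ^ dx t j * (starRingEnd ℂ) (z j) ^ dy t j) • c t

/-- `p : ℂ^m → ℂ_{2n}` is a homogeneous polynomial of bidegree `(a, b)`:
it is polynomial and `p (c z) = c^a (conj c)^b p(z)`. -/
def IsBihom (n m a b : ℕ) (p : (Fin m → ℂ) → Cl n) : Prop :=
  IsPolyMap n m p ∧ ∀ (c : ℂ) (z : Fin m → ℂ),
    p (c • z) = (c ^ a * (starRingEnd ℂ) c ^ b) • p z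

/-- The idempotent `I = (𝔣_1 𝔣_1†)(𝔣_2 𝔣_2†) ⋯ (𝔣_n 𝔣_n†)`. -/
def Iel (n : ℕ) : Cl n := ((List.finRange n).map (fun j => ff n j * ffd n j)).prod

/-- The element `𝔣_{k_1}† ⋯ 𝔣_{k_r}† I` for `s = {k_1 < ⋯ < k_r}`. -/
def blade (n : ℕ) (s : Finset (Fin n)) : Cl n :=
  ((s.sort (· ≤ ·)).map (ffd n)).prod * Iel n

/-- The homogeneous part `(∧_n†)^{(r)} I` of spinor space. -/
def Lam (n r : ℕ) : Submodule ℂ (Cl n) :=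
  Submodule.span ℂ {x | ∃ s : Finset (Fin n), s.card = r ∧ x = blade n s}

/-- The subspace `(∧_{n-1}†)^{(r)}(𝔣_1†,…,𝔣_{n-1}†) I` (all indices `≤ n-1`). -/
def LamT (n r : ℕ) : Submodule ℂ (Cl n) :=
  Submodule.span ℂ
    {x | ∃ s : Finset (Fin n), s.card = r ∧ (∀ j ∈ s, (j : ℕ) + 1 < n) ∧ x = blade n s}

/-- The subspace `(∧_{n-1}†)^{(r-1)}(𝔣_1†,…,𝔣_{n-1}†) 𝔣_n† I`: the span of the blades
`𝔣_{k_1}† ⋯ 𝔣_{k_{r-1}}† 𝔣_n† I` with `k_1 < ⋯ < k_{r-1} ≤ n-1`, i.e. of the `r`-blades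
whose index set contains `n`. -/
def LamQ (n r : ℕ) : Submodule ℂ (Cl n) :=
  Submodule.span ℂ
    {x | ∃ s : Finset (Fin n), s.card = r ∧ (∃ j ∈ s, (j : ℕ) + 1 = n) ∧ x = blade n s}

/-- The embedding `ℂ^{n-1} ≃ {z ∈ ℂ^n : z_n = 0} ⊆ ℂ^n`. -/
def embC (n : ℕ) (x : Fin (n - 1) → ℂ) : Fin n → ℂ :=
  fun i => if h : (i : ℕ) < n - 1 then x ⟨i, h⟩ else 0

open scoped TensorProduct ComplexConjugate

section PolynomialMaps

variable {m : ℕ} {A : Type*} [Ring A] [Algebra ℂ A]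

/-- `A`-valued polynomials in the variables `z_j` (left summand) and `conj z_j` (right summand). -/
abbrev PolyAlg (m : ℕ) (A : Type*) [Ring A] [Algebra ℂ A] : Type _ :=
  MvPolynomial (Fin m ⊕ Fin m) ℂ ⊗[ℂ] A

/-- The values `(z, conj z)` of the variables at a point `z`. -/
def withConj (z : Fin m → ℂ) : Fin m ⊕ Fin m → ℂ := Sum.elim z fun j => conj (z j)

lemma commute_aeval (w : Fin m ⊕ Fin m → ℂ) (P : MvPolynomial (Fin m ⊕ Fin m) ℂ) (c : A) :
    Commute (((Algebra.ofId ℂ A).comp (MvPolynomial.aeval w)) P) (AlgHom.id ℂ A c) :=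
  Algebra.commutes _ c

/-- Evaluation of an `A`-valued polynomial at a point. -/
def evalAt (z : Fin m → ℂ) : PolyAlg m A →ₐ[ℂ] A :=
  Algebra.TensorProduct.lift ((Algebra.ofId ℂ A).comp (MvPolynomial.aeval (withConj z)))
    (AlgHom.id ℂ A) (commute_aeval _)

@[simp]
lemma evalAt_tmul (z : Fin m → ℂ) (P : MvPolynomial (Fin m ⊕ Fin m) ℂ) (c : A) :
    evalAt z (P ⊗ₜ c) = MvPolynomial.eval (withConj z) P • c := by
  rw [evalAt, Algebra.TensorProduct.lift_tmul]
  exact (Algebra.smul_def _ c).symm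

/-- The formal partial derivative in the variable `s`. -/
def partialDeriv (s : Fin m ⊕ Fin m) : PolyAlg m A →ₗ[ℂ] PolyAlg m A :=
  (MvPolynomial.pderiv s).toLinearMap.rTensor A

@[simp]
lemma partialDeriv_tmul (s : Fin m ⊕ Fin m) (P : MvPolynomial (Fin m ⊕ Fin m) ℂ) (c : A) :
    partialDeriv s (P ⊗ₜ c) = MvPolynomial.pderiv s P ⊗ₜ[ℂ] c := by
  simp [partialDeriv]

lemma partialDeriv_tmul_mul (s : Fin m ⊕ Fin m) (P : MvPolynomial (Fin m ⊕ Fin m) ℂ) (c : A)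
    (T : PolyAlg m A) :
    partialDeriv s (P ⊗ₜ c * T) =
      MvPolynomial.pderiv s P ⊗ₜ c * T + P ⊗ₜ c * partialDeriv s T := by
  induction T using TensorProduct.induction_on with
  | zero => simp
  | tmul Q d => simp [Derivation.leibniz, TensorProduct.add_tmul, mul_comm Q, add_comm]
  | add x y hx hy => rw [mul_add, map_add, hx, hy, map_add]; noncomm_ring

lemma pderiv_pderiv_comm {σ R : Type*} [CommSemiring R] (s t : σ) (P : MvPolynomial σ R) :
    MvPolynomial.pderiv s (MvPolynomial.pderiv t P) =
      MvPolynomial.pderiv t (MvPolynomial.pderiv s P) := by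
  classical
  induction P using MvPolynomial.induction_on with
  | C c => simp
  | add p q hp hq => simp only [map_add, hp, hq]
  | mul_X p i hp =>
    simp only [MvPolynomial.pderiv_mul, MvPolynomial.pderiv_X, map_add, hp, Pi.single_apply,
      apply_ite, map_zero, MvPolynomial.pderiv_one]
    split_ifs <;> simp [add_right_comm]

lemma partialDeriv_comm (s t : Fin m ⊕ Fin m) (T : PolyAlg m A) :
    partialDeriv s (partialDeriv t T) = partialDeriv t (partialDeriv s T) := by
  induction T using TensorProduct.induction_on with
  | zero => simp
  | tmul Q d =>
    simp only [partialDeriv_tmul]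
    rw [pderiv_pderiv_comm]
  | add x y hx hy => simp only [map_add, hx, hy]

lemma hasDerivAt_withConj_line (z v : Fin m → ℂ) (s : Fin m ⊕ Fin m) :
    HasDerivAt (fun t : ℝ => withConj (z + t • v) s) (withConj v s) 0 := by
  have h : ∀ w : ℂ, HasDerivAt (fun t : ℝ => (t : ℂ) * w) w 0 := fun w => by
    simpa using (Complex.ofRealCLM.hasDerivAt (x := 0)).mul_const w
  cases s with
  | inl j => simpa [withConj] using (h (v j)).const_add (z j)
  | inr j => simpa [withConj] using (h (conj (v j))).const_add (conj (z j))

lemma hasDerivAt_eval_line (P : MvPolynomial (Fin m ⊕ Fin m) ℂ) (z v : Fin m → ℂ) :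
    HasDerivAt (fun t : ℝ => MvPolynomial.eval (withConj (z + t • v)) P)
      (∑ s, withConj v s * MvPolynomial.eval (withConj z) (MvPolynomial.pderiv s P)) 0 := by
  induction P using MvPolynomial.induction_on with
  | C c => simpa using hasDerivAt_const (0 : ℝ) c
  | add p q hp hq => simpa [mul_add, Finset.sum_add_distrib] using hp.fun_add hq
  | mul_X p s hp =>
    simp only [map_mul, MvPolynomial.eval_X]
    refine (hp.fun_mul (hasDerivAt_withConj_line z v s)).congr_deriv ?_
    simp only [MvPolynomial.pderiv_mul, MvPolynomial.pderiv_X, map_add, map_mul,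
      MvPolynomial.eval_X, mul_add, Finset.sum_add_distrib, Finset.sum_mul, zero_smul, add_zero,
      mul_assoc]
    congr 1
    rw [Finset.sum_eq_single s]
    · simp [mul_comm]
    · intro t _ ht
      simp [Pi.single_eq_of_ne ht.symm]
    · simp

/-- The directional derivative at `z` in the direction `v` of the polynomial map given by `T`. -/
def polyDirDeriv (T : PolyAlg m A) (v z : Fin m → ℂ) : A :=
  ∑ s, withConj v s • evalAt z (partialDeriv s T)

lemma hasDerivAt_evalAt_line (T : PolyAlg m A) (z v : Fin m → ℂ) (φ : A →ₗ[ℂ] ℂ) :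
    HasDerivAt (fun t : ℝ => φ (evalAt (z + t • v) T)) (φ (polyDirDeriv T v z)) 0 := by
  unfold polyDirDeriv
  induction T using TensorProduct.induction_on with
  | zero => simpa using hasDerivAt_const (0 : ℝ) (0 : ℂ)
  | tmul P c =>
    simpa [Finset.sum_mul, add_mul, mul_assoc] using (hasDerivAt_eval_line P z v).mul_const (φ c)
  | add x y hx hy => simpa [Finset.sum_add_distrib] using hx.fun_add hy

lemma continuous_evalAt_smul (T : PolyAlg m A) (z : Fin m → ℂ) (φ : A →ₗ[ℂ] ℂ) :
    Continuous fun c : ℂ => φ (evalAt (c • z) T) := by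
  induction T using TensorProduct.induction_on with
  | zero => simpa using continuous_const
  | tmul P d =>
    simp only [evalAt_tmul, map_smul, smul_eq_mul]
    refine Continuous.mul ?_ continuous_const
    refine (MvPolynomial.continuous_eval P).comp (continuous_pi fun s => ?_)
    cases s with
    | inl j => simpa [withConj] using continuous_id.fun_mul continuous_const
    | inr j => simpa [withConj] using Complex.continuous_conj.fun_mul continuous_const
  | add x y hx hy => simpa using hx.fun_add hy


lemma eq_of_forall_dual_eq {V : Type*} [AddCommGroup V] [Module ℂ V] {d d' : V}
    (h : ∀ φ : V →ₗ[ℂ] ℂ, φ d = φ d') : d = d' := by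
  rw [← sub_eq_zero, ← Module.forall_dual_apply_eq_zero_iff ℂ]
  exact fun φ => by rw [map_sub, h φ, sub_self]

lemma polyDirDeriv_eq_of_hasDerivAt {T : PolyAlg m A} {v z : Fin m → ℂ} {d : A}
    (h : ∀ φ : A →ₗ[ℂ] ℂ, HasDerivAt (fun t : ℝ => φ (evalAt (z + t • v) T)) (φ d) 0) :
    polyDirDeriv T v z = d :=
  eq_of_forall_dual_eq fun φ => (hasDerivAt_evalAt_line T z v φ).unique (h φ)

lemma polyDirDeriv_sub_I_smul (T : PolyAlg m A) (v z : Fin m → ℂ) :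
    polyDirDeriv T v z - Complex.I • polyDirDeriv T (Complex.I • v) z =
      (2 : ℂ) • ∑ j, v j • evalAt z (partialDeriv (Sum.inl j) T) := by
  simp only [polyDirDeriv, Fintype.sum_sum_type, withConj, Sum.elim_inl, Sum.elim_inr,
    Pi.smul_apply, smul_eq_mul, map_mul, Complex.conj_I, smul_add, Finset.smul_sum, smul_smul]
  simp only [← mul_assoc, mul_neg, Complex.I_mul_I, neg_neg, one_mul, neg_mul, neg_smul,
    Finset.sum_neg_distrib, two_mul, add_smul, Finset.sum_add_distrib]
  abel

lemma polyDirDeriv_single_sub (T : PolyAlg m A) (j : Fin m) (c : ℂ) (z : Fin m → ℂ) :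
    polyDirDeriv T (c • Pi.single j 1) z - Complex.I • polyDirDeriv T (c • Pi.single j Complex.I) z =
      (2 : ℂ) • c • evalAt z (partialDeriv (Sum.inl j) T) := by
  have h : (c • Pi.single j Complex.I : Fin m → ℂ) = Complex.I • c • Pi.single j 1 := by
    ext i
    by_cases hi : i = j
    · subst hi; simp [mul_comm]
    · simp [hi]
  rw [h, polyDirDeriv_sub_I_smul, Finset.sum_eq_single j]
  · simp
  · intro i _ hi
    simp [hi]
  · simp

lemma evalAt_partialDeriv_mem {L : Submodule ℂ A} {T : PolyAlg m A} (hT : ∀ z, evalAt z T ∈ L)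
    (j : Fin m) (z : Fin m → ℂ) : evalAt z (partialDeriv (Sum.inl j) T) ∈ L := by
  have hmem : ∀ v, polyDirDeriv T v z ∈ L := fun v => by
    by_contra hv
    obtain ⟨φ, hφ, hL⟩ := Submodule.exists_le_ker_of_notMem hv
    refine hφ ((hasDerivAt_evalAt_line T z v φ).unique ?_)
    simpa [fun t : ℝ => LinearMap.mem_ker.1 (hL (hT (z + t • v)))] using
      hasDerivAt_const (0 : ℝ) (0 : ℂ)
  have h := polyDirDeriv_single_sub T j 1 z
  rw [one_smul ℂ (evalAt _ _), ← inv_smul_eq_iff₀ two_ne_zero] at h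
  rw [← h]
  exact L.smul_mem _ (L.sub_mem (hmem _) (L.smul_mem _ (hmem _)))

/-- Bihomogeneity of bidegree `(a, b)` for the polynomial map given by `T`. -/
def BihomPoly (a b : ℕ) (T : PolyAlg m A) : Prop :=
  ∀ (c : ℂ) (z : Fin m → ℂ), evalAt (c • z) T = (c ^ a * conj c ^ b) • evalAt z T

lemma BihomPoly.polyDirDeriv_smul {a b : ℕ} {T : PolyAlg m A} (hT : BihomPoly a b T) (c : ℂ)
    (v z : Fin m → ℂ) :
    polyDirDeriv T (c • v) (c • z) = (c ^ a * conj c ^ b) • polyDirDeriv T v z := by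
  refine polyDirDeriv_eq_of_hasDerivAt fun φ => ?_
  have h : ∀ t : ℝ, evalAt (c • z + t • c • v) T = (c ^ a * conj c ^ b) • evalAt (z + t • v) T :=
    fun t => by rw [← hT, smul_comm t c v, smul_add]
  simpa [h] using (hasDerivAt_evalAt_line T z v φ).const_mul (c ^ a * conj c ^ b)

lemma BihomPoly.partialDeriv {a b : ℕ} {T : PolyAlg m A} (hT : BihomPoly (a + 1) b T)
    (j : Fin m) : BihomPoly a b (partialDeriv (Sum.inl j) T) := by
  intro c z
  have hne : ∀ c : ℂ, c ≠ 0 → evalAt (c • z) (_root_.partialDeriv (Sum.inl j) T) =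
      (c ^ a * conj c ^ b) • evalAt z (_root_.partialDeriv (Sum.inl j) T) := by
    intro c hc
    have h := polyDirDeriv_single_sub T j c (c • z)
    have h1 := polyDirDeriv_single_sub T j 1 z
    simp only [one_smul] at h1
    rw [hT.polyDirDeriv_smul, hT.polyDirDeriv_smul, smul_comm Complex.I, ← smul_sub, h1,
      smul_comm, smul_right_inj (two_ne_zero' ℂ), pow_succ', mul_assoc, mul_smul,
      smul_right_inj hc] at h
    exact h.symm
  refine eq_of_forall_dual_eq fun φ => ?_
  have hcont : Continuous fun c : ℂ =>
      φ ((c ^ a * conj c ^ b) • evalAt z (_root_.partialDeriv (Sum.inl j) T)) := by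
    simp only [map_smul, smul_eq_mul]
    exact (((continuous_id.pow a).mul (Complex.continuous_conj.pow b)).mul continuous_const)
  exact congrFun (Continuous.ext_on (dense_compl_singleton (0 : ℂ))
    (continuous_evalAt_smul _ z φ) hcont fun c hc => congrArg φ (hne c hc)) c

/-- **Euler's identity** in the holomorphic variables. -/
lemma BihomPoly.sum_smul_partialDeriv {a b : ℕ} {T : PolyAlg m A} (hT : BihomPoly a b T)
    (z : Fin m → ℂ) :
    ∑ j, z j • evalAt z (_root_.partialDeriv (Sum.inl j) T) = (a : ℂ) • evalAt z T := by
  have key : ∀ w : ℂ, polyDirDeriv T (w • z) z = (a * w + b * conj w) • evalAt z T := by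
    intro w
    refine polyDirDeriv_eq_of_hasDerivAt fun φ => ?_
    have h : ∀ t : ℝ, evalAt (z + t • w • z) T =
        ((1 + t * w) ^ a * (1 + t * conj w) ^ b) • evalAt z T := fun t => by
      have := hT (1 + t * w) z
      simp only [map_add, map_one, map_mul, Complex.conj_ofReal] at this
      rw [← this, add_smul, one_smul, mul_smul, Complex.coe_smul]
    have hd : ∀ u : ℂ, HasDerivAt (fun t : ℝ => 1 + (t : ℂ) * u) u 0 := fun u => by
      simpa using ((Complex.ofRealCLM.hasDerivAt (x := 0)).mul_const u).const_add 1
    simpa [h] using ((((hd w).fun_pow a).fun_mul ((hd (conj w)).fun_pow b)).mul_const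
      (φ (evalAt z T)))
  have h := polyDirDeriv_sub_I_smul T z z
  have h1 := key 1
  rw [one_smul] at h1
  rw [h1, key, smul_smul, ← sub_smul] at h
  rw [← smul_right_inj (two_ne_zero' ℂ), ← h, smul_smul]
  congr 1
  simp only [map_one, Complex.conj_I]
  linear_combination (b - a : ℂ) * Complex.I_mul_I

end PolynomialMaps

section CliffordValued

variable {n m : ℕ}

lemma dirDeriv_evalAt (T : PolyAlg m (Cl n)) (v z : Fin m → ℂ) :
    dirDeriv (fun z => evalAt z T) v z = polyDirDeriv T v z := by
  have h : HasDirDeriv (fun z => evalAt z T) z v (polyDirDeriv T v z) :=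
    hasDerivAt_evalAt_line T z v
  exact (polyDirDeriv_eq_of_hasDerivAt
    (Classical.epsilon_spec (p := fun d => HasDirDeriv (fun z => evalAt z T) z v d) ⟨_, h⟩)).symm

lemma pz_evalAt (T : PolyAlg m (Cl n)) (j : Fin m) (z : Fin m → ℂ) :
    pz j (fun z => evalAt z T) z = evalAt z (partialDeriv (Sum.inl j) T) := by
  have h := polyDirDeriv_single_sub T j 1 z
  simp only [one_smul] at h
  rw [pz, dirDeriv_evalAt, dirDeriv_evalAt, h, inv_smul_smul₀ two_ne_zero]

lemma IsPolyMap.add {p q : (Fin m → ℂ) → Cl n} (hp : IsPolyMap n m p) (hq : IsPolyMap n m q) :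
    IsPolyMap n m fun z => p z + q z := by
  obtain ⟨N, c, dx, dy, h⟩ := hp
  obtain ⟨N', c', dx', dy', h'⟩ := hq
  exact ⟨N + N', Fin.append c c', Fin.append dx dx', Fin.append dy dy', fun z => by
    simp [Fin.sum_univ_add, h, h']⟩

lemma isPolyMap_evalAt (T : PolyAlg m (Cl n)) : IsPolyMap n m fun z => evalAt z T := by
  induction T using TensorProduct.induction_on with
  | zero => exact ⟨0, Fin.elim0, Fin.elim0, Fin.elim0, fun z => by simp⟩
  | tmul P d =>
    induction P using MvPolynomial.induction_on' with
    | monomial u a =>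
      refine ⟨1, fun _ => a • d, fun _ j => u (Sum.inl j), fun _ j => u (Sum.inr j), fun z => ?_⟩
      simp [MvPolynomial.eval_monomial, Finsupp.prod_fintype, Finset.prod_mul_distrib, withConj,
        smul_smul, mul_comm]
    | add p q hp hq => simpa [TensorProduct.add_tmul] using hp.add hq
  | add x y hx hy => simpa using hx.add hy

lemma IsPolyMap.exists_evalAt {p : (Fin m → ℂ) → Cl n} (hp : IsPolyMap n m p) :
    ∃ T : PolyAlg m (Cl n), p = fun z => evalAt z T := by
  obtain ⟨N, c, dx, dy, h⟩ := hp
  refine ⟨∑ t, (∏ j, MvPolynomial.X (Sum.inl j) ^ dx t j * MvPolynomial.X (Sum.inr j) ^ dy t j) ⊗ₜ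
    c t, funext fun z => ?_⟩
  simp [h, withConj, map_prod]

end CliffordValued
section WittBasis

variable {n : ℕ}

lemma polar_negQ (k : ℕ) (u v : Fin k → ℂ) :
    QuadraticMap.polar (negQ ℂ k) u v = -2 * ∑ i, u i * v i := by
  simp only [QuadraticMap.polar, negQ, QuadraticMap.weightedSumSquares_apply, Pi.add_apply,
    ← Finset.sum_sub_distrib, Finset.mul_sum, smul_eq_mul]
  exact Finset.sum_congr rfl fun _ _ => by ring

lemma e_mul_e_add (α β : Fin (n + n)) :
    e n α * e n β + e n β * e n α = if α = β then -2 else 0 := by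
  rw [e, e, CliffordAlgebra.ι_mul_ι_add_swap, polar_negQ]
  split_ifs with h
  · subst h
    simp [Pi.single_apply, map_ofNat (algebraMap ℂ (Cl n)) 2]
  · simp [Pi.single_apply, Ne.symm h]

lemma castAdd_ne_natAdd (j k : Fin n) : Fin.castAdd n j ≠ Fin.natAdd n k := by
  intro h
  have := congrArg Fin.val h
  simp at this
  omega

lemma witt_combination (u v : ℂ) (j k : Fin n) :
    (e n (Fin.castAdd n j) + u • e n (Fin.natAdd n j)) *
        (e n (Fin.castAdd n k) + v • e n (Fin.natAdd n k)) +
      (e n (Fin.castAdd n k) + v • e n (Fin.natAdd n k)) *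
        (e n (Fin.castAdd n j) + u • e n (Fin.natAdd n j)) =
      if j = k then (-2 * (1 + u * v)) • (1 : Cl n) else 0 := by
  have h1 := e_mul_e_add (Fin.castAdd n j) (Fin.castAdd n k)
  have h2 := e_mul_e_add (Fin.castAdd n j) (Fin.natAdd n k)
  have h3 := e_mul_e_add (Fin.natAdd n j) (Fin.castAdd n k)
  have h4 := e_mul_e_add (Fin.natAdd n j) (Fin.natAdd n k)
  rw [if_neg (castAdd_ne_natAdd j k)] at h2
  rw [if_neg (castAdd_ne_natAdd k j).symm] at h3
  simp only [Fin.castAdd_inj, Fin.natAdd_inj] at h1 h4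
  generalize e n (Fin.castAdd n j) = a at *
  generalize e n (Fin.castAdd n k) = b at *
  generalize e n (Fin.natAdd n j) = c at *
  generalize e n (Fin.natAdd n k) = d at *
  have : (a + u • c) * (b + v • d) + (b + v • d) * (a + u • c) =
      (a * b + b * a) + v • (a * d + d * a) + u • (c * b + b * c) +
        (u * v) • (c * d + d * c) := by
    simp only [mul_add, add_mul, smul_mul_assoc, mul_smul_comm, smul_add, smul_smul, mul_comm v u]
    abel
  rw [this, h1, h2, h3, h4]
  split_ifs
  · have h : (-2 : Cl n) = (-2 : ℂ) • (1 : Cl n) := by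
      rw [neg_smul, ofNat_smul_eq_nsmul, nsmul_eq_mul]; simp
    rw [h, smul_zero, smul_zero, smul_smul, add_zero, add_zero, ← add_smul]
    congr 1
    ring
  · simp

lemma ff_eq (j : Fin n) : ff n j =
    (2⁻¹ : ℂ) • (e n (Fin.castAdd n j) + (-Complex.I) • e n (Fin.natAdd n j)) := by
  rw [ff, neg_smul, sub_eq_add_neg]

lemma ffd_eq (j : Fin n) : ffd n j =
    (-2⁻¹ : ℂ) • (e n (Fin.castAdd n j) + Complex.I • e n (Fin.natAdd n j)) := by
  rw [ffd, neg_smul]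

lemma ff_mul_ff_add (j k : Fin n) : ff n j * ff n k + ff n k * ff n j = 0 := by
  rw [ff_eq, ff_eq, smul_mul_smul_comm, smul_mul_smul_comm, ← smul_add, witt_combination]
  simp

lemma ffd_mul_ffd_add (j k : Fin n) : ffd n j * ffd n k + ffd n k * ffd n j = 0 := by
  rw [ffd_eq, ffd_eq, smul_mul_smul_comm, smul_mul_smul_comm, ← smul_add, witt_combination]
  simp

lemma ff_mul_ffd_add (j k : Fin n) :
    ff n j * ffd n k + ffd n k * ff n j = if j = k then 1 else 0 := by
  rw [ff_eq, ffd_eq, smul_mul_smul_comm, smul_mul_smul_comm, mul_comm (-2⁻¹ : ℂ), ← smul_add,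
    witt_combination]
  split_ifs
  · rw [smul_smul, neg_mul Complex.I, Complex.I_mul_I]
    norm_num
  · simp

lemma ffd_mul_ff_add (j k : Fin n) :
    ffd n j * ff n k + ff n k * ffd n j = if k = j then 1 else 0 :=
  (add_comm _ _).trans (ff_mul_ffd_add k j)

lemma ff_mul_ff_self (j : Fin n) : ff n j * ff n j = 0 := by
  have h := ff_mul_ff_add j j
  rwa [← two_smul ℂ, smul_eq_zero_iff_right two_ne_zero] at h

lemma ffd_mul_ffd_self (j : Fin n) : ffd n j * ffd n j = 0 := by
  have h := ffd_mul_ffd_add j j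
  rwa [← two_smul ℂ, smul_eq_zero_iff_right two_ne_zero] at h

lemma ff_mul_Iel (j : Fin n) : ff n j * Iel n = 0 := by
  have h : ∀ l : List (Fin n), j ∈ l → ff n j * (l.map fun j => ff n j * ffd n j).prod = 0 := by
    intro l
    induction l with
    | nil => simp
    | cons k l ih =>
      intro hj
      rw [List.map_cons, List.prod_cons]
      by_cases hjk : j = k
      · rw [hjk, ← mul_assoc, ← mul_assoc, ff_mul_ff_self, zero_mul, zero_mul]
      · have hl : j ∈ l := (List.mem_cons.1 hj).resolve_left hjk
        have h1 := eq_neg_of_add_eq_zero_left (ff_mul_ff_add j k)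
        have h2 := ff_mul_ffd_add j k
        rw [if_neg hjk] at h2
        have h3 := eq_neg_of_add_eq_zero_left h2
        rw [← mul_assoc, ← mul_assoc, h1, neg_mul, mul_assoc (ff n k), h3, mul_neg, neg_neg,
          mul_assoc, mul_assoc (ffd n k), ih hl, mul_zero, mul_zero]
  exact h _ (List.mem_finRange j)

/-- The product `𝔣_{k_1}† ⋯ 𝔣_{k_r}† I` along an arbitrary list of indices. -/
def listBlade (l : List (Fin n)) : Cl n := (l.map (ffd n)).prod * Iel n

@[simp]
lemma listBlade_cons (k : Fin n) (l : List (Fin n)) :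
    listBlade (k :: l) = ffd n k * listBlade l := by
  simp [listBlade, mul_assoc]

lemma listBlade_perm {l l' : List (Fin n)} (h : l.Perm l') :
    listBlade l = listBlade l' ∨ listBlade l = -listBlade l' := by
  induction h with
  | nil => exact Or.inl rfl
  | cons k _ ih => rcases ih with ih | ih <;> simp [ih]
  | swap j k l =>
    right
    rw [listBlade_cons, listBlade_cons, listBlade_cons, listBlade_cons, ← mul_assoc, ← mul_assoc,
      ← neg_mul, eq_neg_of_add_eq_zero_left (ffd_mul_ffd_add k j)]
  | trans _ _ ih ih' => rcases ih with ih | ih <;> rcases ih' with ih' | ih' <;> simp [ih, ih']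

lemma ffd_mul_mem_LamT {r : ℕ} {j : Fin n} (hj : (j : ℕ) + 1 < n) {x : Cl n} (hx : x ∈ LamT n r) :
    ffd n j * x ∈ LamT n (r + 1) := by
  induction hx using Submodule.span_induction with
  | zero => simp
  | add x y _ _ hx hy => rw [mul_add]; exact add_mem hx hy
  | smul c x _ hx => rw [mul_smul_comm]; exact Submodule.smul_mem _ _ hx
  | mem x hx =>
    obtain ⟨s, hs, hlt, rfl⟩ := hx
    change ffd n j * listBlade (s.sort (· ≤ ·)) ∈ _
    rw [← listBlade_cons]
    by_cases hjs : j ∈ s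
    · have hperm := List.perm_cons_erase ((Finset.mem_sort (· ≤ ·)).2 hjs)
      have hzero : listBlade (j :: s.sort (· ≤ ·)) = 0 := by
        rcases listBlade_perm (hperm.cons j) with h | h <;>
          rw [h, listBlade_cons, listBlade_cons, ← mul_assoc, ffd_mul_ffd_self] <;> simp
      rw [hzero]
      exact zero_mem _
    · have hperm : (j :: s.sort (· ≤ ·)).Perm ((insert j s).sort (· ≤ ·)) := by
        refine List.Perm.trans ?_ (Finset.sort_perm_toList _ _).symm
        exact ((Finset.sort_perm_toList _ _).cons j).trans (Finset.toList_insert hjs).symm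
      have hmem : blade n (insert j s) ∈ LamT n (r + 1) := by
        refine Submodule.subset_span ⟨_, by rw [Finset.card_insert_of_notMem hjs, hs], ?_, rfl⟩
        intro i hi
        rcases Finset.mem_insert.1 hi with rfl | hi
        exacts [hj, hlt i hi]
      rcases listBlade_perm hperm with h | h <;> rw [h]
      exacts [hmem, neg_mem hmem]

lemma listBlade_mem_LamT {l : List (Fin n)} (hl : ∀ j ∈ l, (j : ℕ) + 1 < n) :
    listBlade l ∈ LamT n l.length := by
  induction l with
  | nil => exact Submodule.subset_span ⟨∅, by simp, by simp, by simp [listBlade, blade]⟩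
  | cons k l ih =>
    rw [listBlade_cons]
    exact ffd_mul_mem_LamT (hl k (by simp)) (ih fun j hj => hl j (by simp [hj]))

lemma ff_mul_listBlade_mem_LamT (j : Fin n) {r : ℕ} {l : List (Fin n)} (hr : l.length = r + 1)
    (hl : ∀ j ∈ l, (j : ℕ) + 1 < n) : ff n j * listBlade l ∈ LamT n r := by
  induction r generalizing l with
  | zero =>
    obtain ⟨k, rfl⟩ := List.length_eq_one_iff.1 hr
    have h := listBlade_mem_LamT (n := n) (l := []) (by simp)
    have h0 : ff n j * listBlade [] = 0 := by simp [listBlade, ff_mul_Iel]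
    rw [listBlade_cons, ← mul_assoc, eq_sub_of_add_eq (ff_mul_ffd_add j k), sub_mul, mul_assoc, h0]
    split_ifs
    · simpa using h
    · simp
  | succ r ih =>
    match l, hr, hl with
    | k :: l, hr, hl =>
      have hlen : l.length = r + 1 := by simpa using hr
      have hl' : ∀ j ∈ l, (j : ℕ) + 1 < n := fun j hj => hl j (by simp [hj])
      have h := listBlade_mem_LamT hl'
      rw [hlen] at h
      rw [listBlade_cons, ← mul_assoc, eq_sub_of_add_eq (ff_mul_ffd_add j k), sub_mul, mul_assoc]
      refine sub_mem ?_ (ffd_mul_mem_LamT (hl k (by simp)) (ih hlen hl'))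
      split_ifs
      · simpa using h
      · simp

lemma ff_mul_mem_LamT (j : Fin n) {r : ℕ} {x : Cl n} (hx : x ∈ LamT n (r + 1)) :
    ff n j * x ∈ LamT n r := by
  induction hx using Submodule.span_induction with
  | zero => simp
  | add x y _ _ hx hy => rw [mul_add]; exact add_mem hx hy
  | smul c x _ hx => rw [mul_smul_comm]; exact Submodule.smul_mem _ _ hx
  | mem x hx =>
    obtain ⟨s, hs, hlt, rfl⟩ := hx
    exact ff_mul_listBlade_mem_LamT (l := s.sort (· ≤ ·)) j (by simp [hs]) (by simpa using hlt)

/-- The embedding of the first `n - 1` indices. -/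
abbrev restrIdx (n : ℕ) : Fin (n - 1) → Fin n := Fin.castLE (Nat.sub_le n 1)

lemma sum_ffd_ff_mul_listBlade {l : List (Fin n)} (hl : ∀ j ∈ l, (j : ℕ) + 1 < n) :
    (∑ j, ffd n (restrIdx n j) * ff n (restrIdx n j)) * listBlade l =
      (l.length : ℂ) • listBlade l := by
  induction l with
  | nil =>
    rw [Finset.sum_mul]
    simp [listBlade, mul_assoc, ff_mul_Iel]
  | cons k l ih =>
    have hk : (k : ℕ) < n - 1 := by have := hl k (by simp); omega
    have hcomm : (∑ j, ffd n (restrIdx n j) * ff n (restrIdx n j)) * ffd n k =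
        ffd n k + ffd n k * ∑ j, ffd n (restrIdx n j) * ff n (restrIdx n j) := by
      have hterm : ∀ j, ffd n (restrIdx n j) * ff n (restrIdx n j) * ffd n k =
          (if j = ⟨k, hk⟩ then ffd n k else 0) +
            ffd n k * (ffd n (restrIdx n j) * ff n (restrIdx n j)) := fun j => by
        rw [mul_assoc, eq_sub_of_add_eq (ff_mul_ffd_add (restrIdx n j) k), mul_sub, ← mul_assoc,
          eq_neg_of_add_eq_zero_left (ffd_mul_ffd_add (restrIdx n j) k), neg_mul, sub_neg_eq_add,
          mul_assoc]
        congr 1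
        by_cases h : j = ⟨k, hk⟩
        · simp [h]
        · have h' : restrIdx n j ≠ k := fun h' => h (Fin.ext (by simpa using congrArg Fin.val h'))
          simp [h, h']
      rw [Finset.sum_mul, Finset.mul_sum, Finset.sum_congr rfl fun j _ => hterm j,
        Finset.sum_add_distrib]
      simp
    rw [listBlade_cons, ← mul_assoc, hcomm, add_mul, mul_assoc, ih fun j hj => hl j (by simp [hj]),
      mul_smul_comm, List.length_cons, Nat.cast_succ, add_smul, one_smul, add_comm]

lemma sum_ffd_ff_mul {r : ℕ} {x : Cl n} (hx : x ∈ LamT n r) :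
    (∑ j, ffd n (restrIdx n j) * ff n (restrIdx n j)) * x = (r : ℂ) • x := by
  induction hx using Submodule.span_induction with
  | zero => simp
  | add x y _ _ hx hy => rw [mul_add, hx, hy, smul_add]
  | smul c x _ hx => rw [mul_smul_comm, hx, smul_comm]
  | mem x hx =>
    obtain ⟨s, hs, hlt, rfl⟩ := hx
    have h := sum_ffd_ff_mul_listBlade (l := s.sort (· ≤ ·)) (by simpa using hlt)
    rwa [Finset.length_sort, hs] at h

end WittBasis
section Fischer

variable {n : ℕ}

/-- The action of `∂_z̃` on Clifford-valued polynomials. -/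
def diracPoly (n : ℕ) (T : PolyAlg (n - 1) (Cl n)) : PolyAlg (n - 1) (Cl n) :=
  ∑ j, 1 ⊗ₜ ffd n (restrIdx n j) * partialDeriv (Sum.inl j) T

/-- The vector variable `z̲̃` as a Clifford-valued polynomial. -/
def vectorPoly (n : ℕ) : PolyAlg (n - 1) (Cl n) :=
  ∑ j, MvPolynomial.X (Sum.inl j) ⊗ₜ ff n (restrIdx n j)

lemma dzT_evalAt (T : PolyAlg (n - 1) (Cl n)) (z : Fin (n - 1) → ℂ) :
    dzT n (fun z => evalAt z T) z = evalAt z (diracPoly n T) := by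
  simp [dzT, pz_evalAt, diracPoly]

lemma evalAt_vectorPoly (z : Fin (n - 1) → ℂ) :
    evalAt z (vectorPoly n) = ∑ j, z j • ff n (restrIdx n j) := by
  simp [vectorPoly, withConj]

lemma diracPoly_add (S T : PolyAlg (n - 1) (Cl n)) :
    diracPoly n (S + T) = diracPoly n S + diracPoly n T := by
  simp only [diracPoly, map_add, mul_add, Finset.sum_add_distrib]

lemma diracPoly_smul (c : ℂ) (T : PolyAlg (n - 1) (Cl n)) :
    diracPoly n (c • T) = c • diracPoly n T := by
  simp only [diracPoly, map_smul, mul_smul_comm, Finset.smul_sum]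

lemma partialDeriv_one_tmul_mul {m : ℕ} (s : Fin m ⊕ Fin m) (c : Cl n) (T : PolyAlg m (Cl n)) :
    partialDeriv s (1 ⊗ₜ c * T) = 1 ⊗ₜ c * partialDeriv s T := by
  rw [partialDeriv_tmul_mul, MvPolynomial.pderiv_one, TensorProduct.zero_tmul, zero_mul, zero_add]

lemma diracPoly_diracPoly (T : PolyAlg (n - 1) (Cl n)) : diracPoly n (diracPoly n T) = 0 := by
  set A : Fin (n - 1) → Fin (n - 1) → PolyAlg (n - 1) (Cl n) := fun j k =>
    1 ⊗ₜ (ffd n (restrIdx n j) * ffd n (restrIdx n k)) *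
      partialDeriv (Sum.inl j) (partialDeriv (Sum.inl k) T) with hA
  have h : diracPoly n (diracPoly n T) = ∑ j, ∑ k, A j k := by
    simp only [diracPoly, map_sum, partialDeriv_one_tmul_mul, Finset.mul_sum, ← mul_assoc,
      Algebra.TensorProduct.tmul_mul_tmul, one_mul, hA]
  have hanti : ∀ j k, A j k + A k j = 0 := fun j k => by
    simp only [hA]
    rw [partialDeriv_comm (Sum.inl k), ← add_mul, ← TensorProduct.tmul_add, ffd_mul_ffd_add,
      TensorProduct.tmul_zero, zero_mul]
  have htwo : (2 : ℂ) • ∑ j, ∑ k, A j k = 0 := by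
    rw [two_smul]
    conv_lhs => enter [2]; rw [Finset.sum_comm]
    simp only [← Finset.sum_add_distrib, hanti, Finset.sum_const_zero]
  exact h.trans ((smul_eq_zero_iff_right two_ne_zero).1 htwo)

lemma partialDeriv_vectorPoly_mul (j : Fin (n - 1)) (T : PolyAlg (n - 1) (Cl n)) :
    partialDeriv (Sum.inl j) (vectorPoly n * T) =
      1 ⊗ₜ ff n (restrIdx n j) * T + vectorPoly n * partialDeriv (Sum.inl j) T := by
  rw [vectorPoly, Finset.sum_mul, map_sum, Finset.sum_mul,
    Finset.sum_congr rfl fun k _ => partialDeriv_tmul_mul _ _ _ T, Finset.sum_add_distrib,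
    Finset.sum_eq_single j]
  · simp
  · intro k _ hk
    simp [MvPolynomial.pderiv_X, hk]
  · simp

lemma one_tmul_ffd_mul_vectorPoly (j : Fin (n - 1)) :
    (1 ⊗ₜ ffd n (restrIdx n j) : PolyAlg (n - 1) (Cl n)) * vectorPoly n =
      MvPolynomial.X (Sum.inl j) ⊗ₜ 1 - vectorPoly n * 1 ⊗ₜ ffd n (restrIdx n j) := by
  rw [eq_sub_iff_add_eq, vectorPoly, Finset.mul_sum, Finset.sum_mul, ← Finset.sum_add_distrib,
    Finset.sum_eq_single j]
  · rw [Algebra.TensorProduct.tmul_mul_tmul, Algebra.TensorProduct.tmul_mul_tmul, one_mul, mul_one,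
      ← TensorProduct.tmul_add, ffd_mul_ff_add, if_pos rfl]
  · intro k _ hk
    have hne : restrIdx n k ≠ restrIdx n j := fun h => hk (by simpa using h)
    rw [Algebra.TensorProduct.tmul_mul_tmul, Algebra.TensorProduct.tmul_mul_tmul, one_mul, mul_one,
      ← TensorProduct.tmul_add, ffd_mul_ff_add, if_neg hne, TensorProduct.tmul_zero]
  · simp

/-- The anticommutator of `∂_z̃` and `z̲̃` is the Euler operator plus the degree operator. -/
lemma diracPoly_vectorPoly_mul (T : PolyAlg (n - 1) (Cl n)) :
    diracPoly n (vectorPoly n * T) =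
      1 ⊗ₜ (∑ j, ffd n (restrIdx n j) * ff n (restrIdx n j)) * T +
        ∑ j, MvPolynomial.X (Sum.inl j) ⊗ₜ 1 * partialDeriv (Sum.inl j) T -
        vectorPoly n * diracPoly n T := by
  simp only [diracPoly, partialDeriv_vectorPoly_mul, mul_add, ← mul_assoc,
    one_tmul_ffd_mul_vectorPoly, sub_mul, Finset.sum_add_distrib, Finset.sum_sub_distrib,
    Finset.mul_sum, Algebra.TensorProduct.tmul_mul_tmul, one_mul, TensorProduct.tmul_sum,
    Finset.sum_mul, add_sub_assoc]

lemma evalAt_diracPoly_vectorPoly_mul {a b r : ℕ} {T : PolyAlg (n - 1) (Cl n)}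
    (hT : BihomPoly a b T) (hval : ∀ z, evalAt z T ∈ LamT n r) (z : Fin (n - 1) → ℂ) :
    evalAt z (diracPoly n (vectorPoly n * T)) =
      ((a + r : ℕ) : ℂ) • evalAt z T - evalAt z (vectorPoly n) * evalAt z (diracPoly n T) := by
  have hE : evalAt z (∑ j, (MvPolynomial.X (Sum.inl j) ⊗ₜ 1 : PolyAlg (n - 1) (Cl n)) *
      partialDeriv (Sum.inl j) T) = (a : ℂ) • evalAt z T := by
    rw [← hT.sum_smul_partialDeriv z]
    simp [withConj]
  rw [diracPoly_vectorPoly_mul, map_sub, map_add, hE, map_mul, map_mul, evalAt_tmul, map_one,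
    one_smul, sum_ffd_ff_mul (hval z), Nat.cast_add, add_smul, add_comm ((r : ℂ) • _)]

lemma evalAt_diracPoly_mem_LamT {r : ℕ} {T : PolyAlg (n - 1) (Cl n)}
    (hval : ∀ z, evalAt z T ∈ LamT n r) (z : Fin (n - 1) → ℂ) :
    evalAt z (diracPoly n T) ∈ LamT n (r + 1) := by
  rw [diracPoly, map_sum]
  refine sum_mem fun j _ => ?_
  rw [map_mul, evalAt_tmul, map_one, one_smul]
  refine ffd_mul_mem_LamT ?_ (evalAt_partialDeriv_mem hval j z)
  have := j.isLt
  simp only [restrIdx, Fin.val_castLE]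
  omega

lemma BihomPoly.diracPoly {a b : ℕ} {T : PolyAlg (n - 1) (Cl n)} (hT : BihomPoly (a + 1) b T) :
    BihomPoly a b (diracPoly n T) := fun c z => by
  simp only [_root_.diracPoly, map_sum, map_mul, evalAt_tmul, map_one, one_smul, Finset.smul_sum,
    (hT.partialDeriv _) c z, mul_smul_comm]

lemma BihomPoly.vectorPoly_mul {a b : ℕ} {T : PolyAlg (n - 1) (Cl n)} (hT : BihomPoly a b T) :
    BihomPoly (a + 1) b (vectorPoly n * T) := fun c z => by
  rw [map_mul, map_mul, hT c z, evalAt_vectorPoly, evalAt_vectorPoly]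
  simp only [Pi.smul_apply, smul_eq_mul, mul_smul, ← Finset.smul_sum, mul_smul_comm,
    smul_mul_assoc, pow_succ]
  congr 1
  rw [smul_comm]

lemma evalAt_vectorPoly_mul_mem_LamT {r : ℕ} {x : Cl n} (hx : x ∈ LamT n (r + 1))
    (z : Fin (n - 1) → ℂ) : evalAt z (vectorPoly n) * x ∈ LamT n r := by
  rw [evalAt_vectorPoly, Finset.sum_mul]
  refine sum_mem fun j _ => ?_
  rw [smul_mul_assoc]
  exact Submodule.smul_mem _ _ (ff_mul_mem_LamT _ hx)

lemma BihomPoly.smul {m a b : ℕ} {T : PolyAlg m (Cl n)} (hT : BihomPoly a b T) (c : ℂ) :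
    BihomPoly a b (c • T) := fun d z => by
  rw [map_smul, map_smul, hT d z, smul_comm]

lemma BihomPoly.sub {m a b : ℕ} {S T : PolyAlg m (Cl n)} (hS : BihomPoly a b S)
    (hT : BihomPoly a b T) : BihomPoly a b (S - T) := fun d z => by
  rw [map_sub, map_sub, hS d z, hT d z, smul_sub]

end Fischer

/-- **Fischer decomposition for `∂_z̃` (Proposition 5.1):**
`𝒫_{a,b,r} = (Ker ∂_z̃ ∩ 𝒫_{a,b,r}) ⊕ z̲̃ (Ker ∂_z̃ ∩ 𝒫_{a-1,b,r+1})`, i.e. every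
`p ∈ 𝒫_{a,b,r}` decomposes uniquely as `p = x + z̲̃ q` with `x ∈ 𝒫_{a,b,r}`, `∂_z̃ x = 0`,
`q ∈ 𝒫_{a-1,b,r+1}`, `∂_z̃ q = 0`, where `z̲̃(z) = ∑_{j<n} 𝔣_j z_j`. -/
theorem fischer_decomposition_dz (n : ℕ) (hn : 2 ≤ n) (a b r : ℕ) (ha : 1 ≤ a)
    (hr : r ≤ n - 2)
    (p : (Fin (n - 1) → ℂ) → Cl n)
    (hpoly : IsBihom n (n - 1) a b p)
    (hval : ∀ z, p z ∈ LamT n r) :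
    ∃! xq : ((Fin (n - 1) → ℂ) → Cl n) × ((Fin (n - 1) → ℂ) → Cl n),
      IsBihom n (n - 1) a b xq.1 ∧ (∀ z, xq.1 z ∈ LamT n r) ∧ (∀ z, dzT n xq.1 z = 0) ∧
      IsBihom n (n - 1) (a - 1) b xq.2 ∧ (∀ z, xq.2 z ∈ LamT n (r + 1)) ∧
      (∀ z, dzT n xq.2 z = 0) ∧
      (∀ z, p z =
        xq.1 z + (∑ j : Fin (n - 1), z j • ff n (Fin.castLE (Nat.sub_le n 1) j)) * xq.2 z) := by
  obtain ⟨a, rfl⟩ : ∃ a', a = a' + 1 := ⟨a - 1, by omega⟩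
  rw [Nat.add_sub_cancel]
  obtain ⟨T, rfl⟩ := hpoly.1.exists_evalAt
  have hT : BihomPoly (a + 1) b T := hpoly.2
  simp only [← evalAt_vectorPoly]
  have hc : ((a + (r + 1) : ℕ) : ℂ) ≠ 0 := Nat.cast_ne_zero.2 (by omega)
  set Q : PolyAlg (n - 1) (Cl n) := ((a + (r + 1) : ℕ) : ℂ)⁻¹ • diracPoly n T with hQ
  have hQbi : BihomPoly a b Q := hT.diracPoly.smul _
  have hQval : ∀ z, evalAt z Q ∈ LamT n (r + 1) := fun z => by
    rw [hQ, map_smul]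
    exact Submodule.smul_mem _ _ (evalAt_diracPoly_mem_LamT hval z)
  have hDQ : diracPoly n Q = 0 := by rw [hQ, diracPoly_smul, diracPoly_diracPoly, smul_zero]
  refine ⟨(fun z => evalAt z (T - vectorPoly n * Q), fun z => evalAt z Q),
    ⟨⟨isPolyMap_evalAt _, hT.sub hQbi.vectorPoly_mul⟩, fun z => ?_, fun z => ?_,
      ⟨isPolyMap_evalAt _, hQbi⟩, hQval, fun z => ?_, fun z => ?_⟩, ?_⟩
  · dsimp only
    rw [map_sub, map_mul]
    exact sub_mem (hval z) (evalAt_vectorPoly_mul_mem_LamT (hQval z) z)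
  · have h := congrArg (evalAt z) (diracPoly_add (T - vectorPoly n * Q) (vectorPoly n * Q))
    rw [sub_add_cancel, map_add, evalAt_diracPoly_vectorPoly_mul hQbi hQval, hDQ, map_zero,
      mul_zero, sub_zero, hQ, map_smul, smul_inv_smul₀ hc, right_eq_add] at h
    rw [dzT_evalAt, h]
  · rw [dzT_evalAt, hDQ, map_zero]
  · dsimp only
    rw [map_sub, map_mul, sub_add_cancel]
  · rintro ⟨x, q⟩ ⟨hx, -, hDx, hq, hqval, hDq, hdec⟩
    dsimp only at hx hDx hq hqval hDq hdec
    obtain ⟨S, rfl⟩ := hx.1.exists_evalAt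
    obtain ⟨R, rfl⟩ := hq.1.exists_evalAt
    have hR : BihomPoly a b R := hq.2
    have hq_eq : ∀ z, evalAt z R = evalAt z Q := fun z => by
      have hfun : (fun z => evalAt z T) = fun z => evalAt z (S + vectorPoly n * R) :=
        funext fun z => by rw [hdec, map_add, map_mul]
      have h := congrArg (fun g => dzT n g z) hfun
      have h1 := hDx z
      have h2 := hDq z
      rw [dzT_evalAt] at h1 h2
      rw [dzT_evalAt, dzT_evalAt, diracPoly_add, map_add, h1, zero_add,
        evalAt_diracPoly_vectorPoly_mul hR hqval, h2, mul_zero, sub_zero] at h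
      rw [hQ, map_smul, h, inv_smul_smul₀ hc]
    refine Prod.ext (funext fun z => ?_) (funext hq_eq)
    dsimp only
    rw [map_sub, map_mul, ← hq_eq, hdec, add_sub_cancel_right]
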